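/- Let n ≥ 1, and for j ∈ Λ_n define ℓ^Δ_{j,n}(t) = λ_j^{(n)} · (P⁺ Φ_n*(· − j/n))(t), where P⁺ acts in the variable t. Then for every function f : ℝ³_H → ℂ, the function L_n* f(t) = Σ_{j ∈ Λ_n} f(j/n) ℓ^Δ_{j,n}(t) belongs to the complex span of {TC_k : k ∈ Λ_n} and satisfies L_n* f(j/n) = f(j/n) for every j ∈ Λ_n; moreover L_n* f is the unique function in that span taking these values at the points j/n, j ∈ Λ_n. -/

import Mathlib

open MeasureTheory
open scoped Real Classical

noncomputable section

/-- `φ_j(t) = exp(2πi (j₁t₁ + j₂t₂ + j₃t₃)/3)` for `j ∈ ℤ³`, `t ∈ ℝ³`. -/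
def phi (j : ℤ × ℤ × ℤ) (t : ℝ × ℝ × ℝ) : ℂ :=
  Complex.exp (2 * (Real.pi : ℂ) * Complex.I *
    ((j.1 : ℂ) * (t.1 : ℂ) + (j.2.1 : ℂ) * (t.2.1 : ℂ) + (j.2.2 : ℂ) * (t.2.2 : ℂ)) / 3)

/-- The generalized cosine `TC_k`. -/
def TCos (k : ℤ × ℤ × ℤ) (t : ℝ × ℝ × ℝ) : ℂ :=
  (1 / 6) * (phi k t + phi (k.2.1, k.2.2, k.1) t + phi (k.2.2, k.1, k.2.1) t +
    phi (-k.1, -k.2.2, -k.2.1) t + phi (-k.2.1, -k.1, -k.2.2) t +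
    phi (-k.2.2, -k.2.1, -k.1) t)

/-- The generalized sine `TS_k`. -/
def TSin (k : ℤ × ℤ × ℤ) (t : ℝ × ℝ × ℝ) : ℂ :=
  (1 / (6 * Complex.I)) * (phi k t + phi (k.2.1, k.2.2, k.1) t + phi (k.2.2, k.1, k.2.1) t -
    phi (-k.1, -k.2.2, -k.2.1) t - phi (-k.2.1, -k.1, -k.2.2) t -
    phi (-k.2.2, -k.2.1, -k.1) t)

/-- The point `j/n = (j₁/n, j₂/n, j₃/n)`. -/
def pt (n : ℕ) (j : ℤ × ℤ × ℤ) : ℝ × ℝ × ℝ :=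
  ((j.1 : ℝ) / n, (j.2.1 : ℝ) / n, (j.2.2 : ℝ) / n)

/-- The triangle `Δ = {(t₁,t₂) : t₁ ≥ 0, t₂ ≥ 0, t₁+t₂ ≤ 1}`. -/
def TriDelta : Set (ℝ × ℝ) := {p | 0 ≤ p.1 ∧ 0 ≤ p.2 ∧ p.1 + p.2 ≤ 1}

/-- Embedding `(t₁,t₂) ↦ (t₁,t₂,-t₁-t₂)` into the plane `t₁+t₂+t₃=0`. -/
def emb (p : ℝ × ℝ) : ℝ × ℝ × ℝ := (p.1, p.2, -p.1 - p.2)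

/-- `⟨f,g⟩_Δ = 2 ∫_Δ f(t₁,t₂,-t₁-t₂) conj(g(t₁,t₂,-t₁-t₂)) dt₁dt₂`. -/
def innerD (f g : ℝ × ℝ × ℝ → ℂ) : ℂ :=
  2 * ∫ p in TriDelta, f (emb p) * (starRingEnd ℂ) (g (emb p))

/-- `Λ = {k ∈ ℍ : k₁ ≥ 0, k₂ ≥ 0, k₃ ≤ 0}`. -/
def Lam : Set (ℤ × ℤ × ℤ) :=
  {k | k.1 + k.2.1 + k.2.2 = 0 ∧ 0 ≤ k.1 ∧ 0 ≤ k.2.1 ∧ k.2.2 ≤ 0}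

/-- `Λ° = {k ∈ Λ : k₁ > 0, k₂ > 0, k₃ < 0}`. -/
def LamCirc : Set (ℤ × ℤ × ℤ) :=
  {k | k.1 + k.2.1 + k.2.2 = 0 ∧ 0 < k.1 ∧ 0 < k.2.1 ∧ k.2.2 < 0}

/-- `Λ_n = {k ∈ Λ : -k₃ ≤ n}`. -/
def Lamn (n : ℕ) : Set (ℤ × ℤ × ℤ) :=
  {k | k.1 + k.2.1 + k.2.2 = 0 ∧ 0 ≤ k.1 ∧ 0 ≤ k.2.1 ∧ -k.2.2 ≤ (n : ℤ)}

/-- `Λ_n° = {k ∈ Λ_n : k₁ > 0, k₂ > 0, -k₃ < n}`. -/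
def LamnCirc (n : ℕ) : Set (ℤ × ℤ × ℤ) :=
  {k | k.1 + k.2.1 + k.2.2 = 0 ∧ 0 < k.1 ∧ 0 < k.2.1 ∧ -k.2.2 < (n : ℤ)}

/-- Weights `λ_j^{(n)}`: 6 on interior points, 1 on the three vertices, 3 on edge points. -/
def lamwt (n : ℕ) (j : ℤ × ℤ × ℤ) : ℝ :=
  if 0 < j.1 ∧ 0 < j.2.1 ∧ -j.2.2 < (n : ℤ) then 6
  else if j = ((n : ℤ), 0, -(n : ℤ)) ∨ j = (0, (n : ℤ), -(n : ℤ)) ∨ j = (0, 0, 0) then 1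
  else 3

/-- `ℍ_n* = {j ∈ ℍ : -n ≤ j₁, j₂, j₃ ≤ n}`. -/
def Hstar (n : ℕ) : Set (ℤ × ℤ × ℤ) :=
  {j | j.1 + j.2.1 + j.2.2 = 0 ∧ -(n : ℤ) ≤ j.1 ∧ j.1 ≤ n ∧
       -(n : ℤ) ≤ j.2.1 ∧ j.2.1 ≤ n ∧ -(n : ℤ) ≤ j.2.2 ∧ j.2.2 ≤ n}

/-- The weights `c_j^{(n)}`: 1 on interior points, 1/2 on edge points, 1/3 on vertices. -/
def cwt (n : ℕ) (j : ℤ × ℤ × ℤ) : ℝ :=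
  if -(n : ℤ) < j.1 ∧ j.1 < n ∧ -(n : ℤ) < j.2.1 ∧ j.2.1 < n ∧
      -(n : ℤ) < j.2.2 ∧ j.2.2 < n then 1
  else if j.1 * j.2.1 * j.2.2 ≠ 0 then 1 / 2 else 1 / 3

/-- `Φ_n*(t) = (1/(3n²)) Σ_{j ∈ ℍ_n*} c_j^{(n)} φ_j(t)`. -/
def PhiStar (n : ℕ) (t : ℝ × ℝ × ℝ) : ℂ :=
  ((1 / (3 * (n : ℝ) ^ 2) : ℝ) : ℂ) * ∑ᶠ j ∈ Hstar n, ((cwt n j : ℝ) : ℂ) * phi j t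

/-- The invariant projection `P⁺`. -/
def Pplus (g : ℝ × ℝ × ℝ → ℂ) (t : ℝ × ℝ × ℝ) : ℂ :=
  (1 / 6) * (g (t.1, t.2.1, t.2.2) + g (t.2.2, t.1, t.2.1) + g (t.2.1, t.2.2, t.1) +
    g (-t.1, -t.2.2, -t.2.1) + g (-t.2.1, -t.1, -t.2.2) + g (-t.2.2, -t.2.1, -t.1))

/-- Fundamental interpolation functions `ℓ^Δ_{j,n}(t) = λ_j^{(n)} (P⁺ Φ_n*(· - j/n))(t)`. -/
def ellD (n : ℕ) (j : ℤ × ℤ × ℤ) (t : ℝ × ℝ × ℝ) : ℂ :=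
  ((lamwt n j : ℝ) : ℂ) * Pplus (fun s => PhiStar n (s - pt n j)) t

lemma phi_add_left (j k : ℤ × ℤ × ℤ) (t : ℝ × ℝ × ℝ) : phi (j + k) t = phi j t * phi k t := by
  simp only [phi, ← Complex.exp_add, Prod.fst_add, Prod.snd_add]
  congr 1; push_cast; ring

lemma phi_zero_left (t : ℝ × ℝ × ℝ) : phi 0 t = 1 := by
  simp [phi]

lemma phi_nsmul_left (a : ℕ) (j : ℤ × ℤ × ℤ) (t : ℝ × ℝ × ℝ) :
    phi (a • j) t = phi j t ^ a := by
  induction a with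
  | zero => simp [phi_zero_left]
  | succ a ih => rw [succ_nsmul, phi_add_left, ih, pow_succ]

lemma phi_sub_right (k : ℤ × ℤ × ℤ) (s t : ℝ × ℝ × ℝ) :
    phi k (s - t) = phi k s * phi k (-t) := by
  simp only [phi, ← Complex.exp_add, Prod.fst_sub, Prod.snd_sub, Prod.fst_neg, Prod.snd_neg]
  congr 1; push_cast; ring

/-- The hexagonal index set `ℍ_n*` as a finset. -/
def hexFinset (n : ℕ) : Finset (ℤ × ℤ × ℤ) :=
  (Finset.Icc (-(n : ℤ)) n ×ˢ Finset.Icc (-(n : ℤ)) n ×ˢ Finset.Icc (-(n : ℤ)) n).filter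
    fun k => k.1 + k.2.1 + k.2.2 = 0

lemma mem_hexFinset {n : ℕ} {k : ℤ × ℤ × ℤ} : k ∈ hexFinset n ↔ k ∈ Hstar n := by
  simp only [hexFinset, Hstar, Finset.mem_filter, Finset.mem_product, Finset.mem_Icc,
    Set.mem_ofPred_eq]
  tauto

lemma coe_hexFinset (n : ℕ) : (hexFinset n : Set (ℤ × ℤ × ℤ)) = Hstar n :=
  Set.ext fun _ => mem_hexFinset

lemma PhiStar_eq_sum (n : ℕ) (t : ℝ × ℝ × ℝ) :
    PhiStar n t = 1 / (3 * (n : ℂ) ^ 2) * ∑ k ∈ hexFinset n, (cwt n k : ℂ) * phi k t := by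
  rw [PhiStar, ← coe_hexFinset, finsum_mem_coe_finset]
  push_cast; rfl

/-- Six times the weight `c_k` as a combination of indicators of half-open rhombi and of
single points. -/
lemma six_mul_weight_eq_indicators {n : ℤ} (hn : 1 ≤ n) {a b c : ℤ}
    (hk : a + b + c = 0 ∧ -n ≤ a ∧ a ≤ n ∧ -n ≤ b ∧ b ≤ n ∧ -n ≤ c ∧ c ≤ n) :
    (if -n < a ∧ a < n ∧ -n < b ∧ b < n ∧ -n < c ∧ c < n then 6
      else if (a ≠ 0 ∧ b ≠ 0) ∧ c ≠ 0 then 3 else (2 : ℤ)) =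
      3 * ((if 0 ≤ a ∧ a < n ∧ c < 0 ∧ -n ≤ c then 1 else 0)
        + (if 0 ≤ b ∧ b < n ∧ a < 0 ∧ -n ≤ a then 1 else 0)
        + (if 0 ≤ c ∧ c < n ∧ b < 0 ∧ -n ≤ b then 1 else 0)
        + (if 0 < a ∧ a ≤ n ∧ c ≤ 0 ∧ -n < c then 1 else 0)
        + (if 0 < b ∧ b ≤ n ∧ a ≤ 0 ∧ -n < a then 1 else 0)
        + (if 0 < c ∧ c ≤ n ∧ b ≤ 0 ∧ -n < b then 1 else 0))
      + 6 * (if a = 0 ∧ b = 0 ∧ c = 0 then 1 else 0)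
      - 4 * ((if a = n ∧ b = -n ∧ c = 0 then 1 else 0)
        + (if a = 0 ∧ b = n ∧ c = -n then 1 else 0)
        + (if a = -n ∧ b = 0 ∧ c = n then 1 else 0))
      + 2 * ((if a = -n ∧ b = n ∧ c = 0 then 1 else 0)
        + (if a = 0 ∧ b = -n ∧ c = n then 1 else 0)
        + (if a = n ∧ b = 0 ∧ c = -n then 1 else 0)) := by
  grind (splits := 40)

lemma cwt_eq_indicators {n : ℕ} (hn : 1 ≤ n) {k : ℤ × ℤ × ℤ} (hk : k ∈ Hstar n) :
    (cwt n k : ℂ) =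
      1 / 2 * ((if 0 ≤ k.1 ∧ k.1 < n ∧ k.2.2 < 0 ∧ -(n : ℤ) ≤ k.2.2 then 1 else 0)
        + (if 0 ≤ k.2.1 ∧ k.2.1 < n ∧ k.1 < 0 ∧ -(n : ℤ) ≤ k.1 then 1 else 0)
        + (if 0 ≤ k.2.2 ∧ k.2.2 < n ∧ k.2.1 < 0 ∧ -(n : ℤ) ≤ k.2.1 then 1 else 0)
        + (if 0 < k.1 ∧ k.1 ≤ n ∧ k.2.2 ≤ 0 ∧ -(n : ℤ) < k.2.2 then 1 else 0)
        + (if 0 < k.2.1 ∧ k.2.1 ≤ n ∧ k.1 ≤ 0 ∧ -(n : ℤ) < k.1 then 1 else 0)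
        + (if 0 < k.2.2 ∧ k.2.2 ≤ n ∧ k.2.1 ≤ 0 ∧ -(n : ℤ) < k.2.1 then 1 else 0))
      + (if k = (0, 0, 0) then 1 else 0)
      - 2 / 3 * ((if k = ((n : ℤ), -(n : ℤ), 0) then 1 else 0)
        + (if k = (0, (n : ℤ), -(n : ℤ)) then 1 else 0)
        + (if k = (-(n : ℤ), 0, (n : ℤ)) then 1 else 0))
      + 1 / 3 * ((if k = (-(n : ℤ), (n : ℤ), 0) then 1 else 0)
        + (if k = (0, -(n : ℤ), (n : ℤ)) then 1 else 0)
        + (if k = ((n : ℤ), 0, -(n : ℤ)) then 1 else 0)) := by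
  obtain ⟨a, b, c⟩ := k
  have h := congrArg (Int.cast : ℤ → ℂ)
    (six_mul_weight_eq_indicators (n := n) (by omega) (a := a) (b := b) (c := c) hk)
  simp only [cwt, Prod.mk.injEq, mul_ne_zero_iff]
  push_cast at h ⊢
  simp only [apply_ite ((↑) : ℝ → ℂ)]
  have h6 (p q : Prop) [Decidable p] [Decidable q] :
      (if p then ((1 : ℝ) : ℂ) else if q then ((1 / 2 : ℝ) : ℂ) else ((1 / 3 : ℝ) : ℂ)) =
        1 / 6 * (if p then 6 else if q then 3 else 2) := by
    split_ifs <;> norm_num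
  rw [h6, h]
  ring

lemma geom_hexagon {n : ℕ} {X Y Z w : ℂ} (hX : X ^ n = w) (hY : Y ^ n = w) (hZ : Z ^ n = w)
    (hXYZ : X * Y * Z = 1) (hw : w ^ 3 = 1) :
    1 / 2 * ((∑ a ∈ Finset.range n, X ^ a) * (∑ b ∈ Finset.range n, Y ^ b) * (X + Y)
      + (∑ a ∈ Finset.range n, Y ^ a) * (∑ b ∈ Finset.range n, Z ^ b) * (Y + Z)
      + (∑ a ∈ Finset.range n, Z ^ a) * (∑ b ∈ Finset.range n, X ^ b) * (Z + X))
      + 1 - 2 * w + w ^ 2 = if X = 1 ∧ Y = 1 then 3 * (n : ℂ) ^ 2 else 0 := by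
  have gX := geom_sum_mul X n
  have gY := geom_sum_mul Y n
  have gZ := geom_sum_mul Z n
  rw [hX] at gX; rw [hY] at gY; rw [hZ] at gZ
  split_ifs with h
  · obtain ⟨rfl, rfl⟩ := h
    obtain rfl : Z = 1 := by simpa using hXYZ
    obtain rfl : w = 1 := by simpa using hX.symm
    simp; ring
  · by_cases h1 : w = 1
    · subst h1
      simp only [sub_self, mul_eq_zero, sub_eq_zero] at gX gY gZ
      rcases gX with gX | rfl <;> rcases gY with gY | rfl <;> rcases gZ with gZ | rfl <;>
        simp_all <;> norm_num
    · have nX : X - 1 ≠ 0 := fun hx => h1 (by rw [hx] at gX; linear_combination -gX)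
      have nY : Y - 1 ≠ 0 := fun hx => h1 (by rw [hx] at gY; linear_combination -gY)
      have nZ : Z - 1 ≠ 0 := fun hx => h1 (by rw [hx] at gZ; linear_combination -gZ)
      rw [← eq_div_iff nX] at gX
      rw [← eq_div_iff nY] at gY
      rw [← eq_div_iff nZ] at gZ
      rw [gX, gY, gZ]
      field_simp
      linear_combination (w - 1) ^ 2 * 2 * hXYZ

/-- Orbit representatives modulo the finite reflection group. -/
lemma TCos_mem_span {n : ℕ} {k : ℤ × ℤ × ℤ} (hk : k ∈ Hstar n) :
    TCos k ∈ Submodule.span ℂ {F | ∃ k ∈ Lamn n, F = TCos k} := by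
  obtain ⟨a, b, c⟩ := k
  simp only [Hstar, Set.mem_ofPred_eq] at hk
  have key (a' b' c' : ℤ) (h : TCos (a, b, c) = TCos (a', b', c'))
      (hm : a' + b' + c' = 0 ∧ 0 ≤ a' ∧ 0 ≤ b' ∧ -c' ≤ n) :
      TCos (a, b, c) ∈ Submodule.span ℂ {F | ∃ k ∈ Lamn n, F = TCos k} :=
    Submodule.subset_span ⟨(a', b', c'), hm, h⟩
  have cases : (0 ≤ a ∧ 0 ≤ b) ∨ (0 ≤ b ∧ 0 ≤ c) ∨ (0 ≤ c ∧ 0 ≤ a) ∨ (a ≤ 0 ∧ b ≤ 0) ∨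
      (b ≤ 0 ∧ c ≤ 0) ∨ (c ≤ 0 ∧ a ≤ 0) := by omega
  rcases cases with h | h | h | h | h | h
  · exact key a b c rfl (by omega)
  · refine key b c a ?_ (by omega)
    funext t; simp only [TCos]; ring
  · refine key c a b ?_ (by omega)
    funext t; simp only [TCos]; ring
  · refine key (-b) (-a) (-c) ?_ (by omega)
    funext t; simp only [TCos, neg_neg]; ring
  · refine key (-c) (-b) (-a) ?_ (by omega)
    funext t; simp only [TCos, neg_neg]; ring
  · refine key (-a) (-c) (-b) ?_ (by omega)
    funext t; simp only [TCos, neg_neg]; ring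

lemma Pplus_phi (k : ℤ × ℤ × ℤ) (u t : ℝ × ℝ × ℝ) :
    Pplus (fun s => phi k (s - u)) t = phi k (-u) * TCos k t := by
  simp only [Pplus, TCos, phi_sub_right]
  have h (s : ℝ × ℝ × ℝ) (l : ℤ × ℤ × ℤ)
    (e : (k.1 : ℂ) * (s.1 : ℂ) + (k.2.1 : ℂ) * (s.2.1 : ℂ) + (k.2.2 : ℂ) * (s.2.2 : ℂ) =
      (l.1 : ℂ) * (t.1 : ℂ) + (l.2.1 : ℂ) * (t.2.1 : ℂ) + (l.2.2 : ℂ) * (t.2.2 : ℂ)) :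
    phi k s = phi l t := by simp only [phi, e]
  rw [h (t.1, t.2.1, t.2.2) k (by ring), h (t.2.2, t.1, t.2.1) (k.2.1, k.2.2, k.1) (by ring),
    h (t.2.1, t.2.2, t.1) (k.2.2, k.1, k.2.1) (by ring),
    h (-t.1, -t.2.2, -t.2.1) (-k.1, -k.2.2, -k.2.1) (by push_cast; ring),
    h (-t.2.1, -t.1, -t.2.2) (-k.2.1, -k.1, -k.2.2) (by push_cast; ring),
    h (-t.2.2, -t.2.1, -t.1) (-k.2.2, -k.2.1, -k.1) (by push_cast; ring)]
  ring

lemma ellD_eq_sum (n : ℕ) (j : ℤ × ℤ × ℤ) :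
    ellD n j = ∑ k ∈ hexFinset n,
      ((lamwt n j : ℂ) * (1 / (3 * (n : ℂ) ^ 2)) * cwt n k * phi k (-pt n j)) • TCos k := by
  funext t
  have h : Pplus (fun s => PhiStar n (s - pt n j)) t = 1 / (3 * (n : ℂ) ^ 2) *
      ∑ k ∈ hexFinset n, (cwt n k : ℂ) * Pplus (fun s => phi k (s - pt n j)) t := by
    simp only [Pplus, PhiStar_eq_sum, Finset.mul_sum, ← Finset.sum_add_distrib]
    refine Finset.sum_congr rfl fun k _ => ?_
    ring
  rw [ellD, h, Finset.mul_sum, Finset.mul_sum, Finset.sum_apply]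
  refine Finset.sum_congr rfl fun k _ => ?_
  rw [Pplus_phi, Pi.smul_apply, smul_eq_mul]
  ring

lemma ellD_mem_span (n : ℕ) (j : ℤ × ℤ × ℤ) :
    ellD n j ∈ Submodule.span ℂ {F | ∃ k ∈ Lamn n, F = TCos k} := by
  rw [ellD_eq_sum]
  exact Submodule.sum_mem _ fun k hk =>
    Submodule.smul_mem _ _ (TCos_mem_span (mem_hexFinset.1 hk))

/-- Exponential sum over a half-open rhombus spanned by `u` and `v`. -/
lemma sum_rhombus {n : ℕ} (t : ℝ × ℝ × ℝ) (u v : ℤ × ℤ × ℤ) (P : ℤ × ℤ × ℤ → Prop)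
    [DecidablePred P] (α β : ℤ × ℤ × ℤ → ℤ)
    (hmem : ∀ a b : ℕ, a < n → b < n → a • u + (b + 1) • v ∈ Hstar n ∧
      P (a • u + (b + 1) • v) ∧ α (a • u + (b + 1) • v) = a ∧ β (a • u + (b + 1) • v) = b)
    (hinv : ∀ k ∈ Hstar n, P k → 0 ≤ α k ∧ α k < n ∧ 0 ≤ β k ∧ β k < n ∧
      α k • u + (β k + 1) • v = k) :
    ∑ k ∈ hexFinset n, (if P k then 1 else 0) * phi k t =
      (∑ a ∈ Finset.range n, phi u t ^ a) * (∑ b ∈ Finset.range n, phi v t ^ b) * phi v t := by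
  simp only [ite_mul, one_mul, zero_mul]
  rw [← Finset.sum_filter, Finset.sum_mul_sum, ← Finset.sum_product', Finset.sum_mul]
  symm
  refine Finset.sum_nbij' (fun p => p.1 • u + (p.2 + 1) • v)
    (fun k => ((α k).toNat, (β k).toNat)) ?_ ?_ ?_ ?_ ?_
  · rintro ⟨a, b⟩ h
    simp only [Finset.mem_product, Finset.mem_range] at h
    have := hmem a b h.1 h.2
    simp only [Finset.mem_filter, mem_hexFinset]
    exact ⟨this.1, this.2.1⟩
  · intro k h
    simp only [Finset.mem_filter, mem_hexFinset] at h
    have := hinv k h.1 h.2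
    simp only [Finset.mem_product, Finset.mem_range]
    omega
  · rintro ⟨a, b⟩ h
    simp only [Finset.mem_product, Finset.mem_range] at h
    have := hmem a b h.1 h.2
    simp only [this.2.2.1, this.2.2.2, Int.toNat_natCast]
  · intro k h
    simp only [Finset.mem_filter, mem_hexFinset] at h
    obtain ⟨h1, -, h2, -, h3⟩ := hinv k h.1 h.2
    conv_rhs => rw [← h3]
    rw [← natCast_zsmul, ← natCast_zsmul]
    push_cast
    rw [Int.toNat_of_nonneg h1, Int.toNat_of_nonneg h2]
  · rintro ⟨a, b⟩ -
    rw [phi_add_left, phi_nsmul_left, phi_nsmul_left, pow_succ, mul_assoc]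

lemma phi_pt_eq_one_iff {n : ℕ} (hn : 1 ≤ n) (k m : ℤ × ℤ × ℤ) :
    phi k (pt n m) = 1 ↔ (3 * n : ℤ) ∣ k.1 * m.1 + k.2.1 * m.2.1 + k.2.2 * m.2.2 := by
  have hn0 : (n : ℂ) ≠ 0 := by exact_mod_cast (by omega : n ≠ 0)
  have hpi : (Real.pi : ℂ) ≠ 0 := by exact_mod_cast Real.pi_ne_zero
  rw [phi, Complex.exp_eq_one_iff]
  refine exists_congr fun q => ?_
  have e : 2 * (Real.pi : ℂ) * Complex.I * ((k.1 : ℂ) * ((pt n m).1 : ℂ) +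
      (k.2.1 : ℂ) * ((pt n m).2.1 : ℂ) + (k.2.2 : ℂ) * ((pt n m).2.2 : ℂ)) / 3 =
      ((k.1 * m.1 + k.2.1 * m.2.1 + k.2.2 * m.2.2 : ℤ) : ℂ) / (3 * n) *
        (2 * Real.pi * Complex.I) := by
    simp only [pt]; push_cast; field_simp
  rw [e, mul_left_inj' Complex.two_pi_I_ne_zero, div_eq_iff (by simpa using hn0), mul_comm (q : ℂ)]
  exact_mod_cast Iff.rfl

lemma sum_hexFinset {n : ℕ} (hn : 1 ≤ n) {m : ℤ × ℤ × ℤ} (hm : m.1 + m.2.1 + m.2.2 = 0) :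
    ∑ k ∈ hexFinset n, (cwt n k : ℂ) * phi k (pt n m) =
      if (3 * n : ℤ) ∣ m.1 - m.2.1 ∧ (3 * n : ℤ) ∣ m.2.1 - m.2.2 then 3 * (n : ℂ) ^ 2 else 0 := by
  set t := pt n m
  have hXY : phi (1, -1, 0) t ^ n = phi (0, 1, -1) t ^ n := by
    have h : phi (n • (1, -2, 1)) t = 1 := by
      rw [phi_pt_eq_one_iff hn]
      refine ⟨-m.2.1, ?_⟩
      simp only [Prod.smul_mk, nsmul_eq_mul]
      linear_combination (n : ℤ) * hm
    rw [← phi_nsmul_left, ← phi_nsmul_left, ← one_mul (phi (n • (0, 1, -1)) t), ← h,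
      ← phi_add_left, ← smul_add]
    rfl
  have hZX : phi (-1, 0, 1) t ^ n = phi (1, -1, 0) t ^ n := by
    have h : phi (n • (-2, 1, 1)) t = 1 := by
      rw [phi_pt_eq_one_iff hn]
      refine ⟨-m.1, ?_⟩
      simp only [Prod.smul_mk, nsmul_eq_mul]
      linear_combination (n : ℤ) * hm
    rw [← phi_nsmul_left, ← phi_nsmul_left, ← one_mul (phi (n • (1, -1, 0)) t), ← h,
      ← phi_add_left, ← smul_add]
    rfl
  have hw : (phi (1, -1, 0) t ^ n) ^ 3 = 1 := by
    rw [← phi_nsmul_left, ← phi_nsmul_left, phi_pt_eq_one_iff hn]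
    refine ⟨m.1 - m.2.1, ?_⟩
    simp only [Prod.smul_mk, nsmul_eq_mul]
    push_cast
    ring
  have hXYZ : phi (1, -1, 0) t * phi (0, 1, -1) t * phi (-1, 0, 1) t = 1 := by
    rw [← phi_add_left, ← phi_add_left]
    exact phi_zero_left t
  have zero : phi (0, 0, 0) t = 1 := phi_zero_left t
  have near₁ : phi ((n : ℤ), -(n : ℤ), 0) t = phi (1, -1, 0) t ^ n := by
    rw [← phi_nsmul_left]; simp
  have near₂ : phi (0, (n : ℤ), -(n : ℤ)) t = phi (1, -1, 0) t ^ n := by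
    rw [hXY, ← phi_nsmul_left]; simp
  have near₃ : phi (-(n : ℤ), 0, (n : ℤ)) t = phi (1, -1, 0) t ^ n := by
    rw [← hZX, ← phi_nsmul_left]; simp
  have far₁ : phi (-(n : ℤ), (n : ℤ), 0) t = (phi (1, -1, 0) t ^ n) ^ 2 := by
    rw [sq]; nth_rw 1 [← near₂]; rw [← near₃, ← phi_add_left]; simp
  have far₂ : phi (0, -(n : ℤ), (n : ℤ)) t = (phi (1, -1, 0) t ^ n) ^ 2 := by
    rw [sq]; nth_rw 1 [← near₃]; rw [← near₁, ← phi_add_left]; simp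
  have far₃ : phi ((n : ℤ), 0, -(n : ℤ)) t = (phi (1, -1, 0) t ^ n) ^ 2 := by
    rw [sq]; nth_rw 1 [← near₁]; rw [← near₂, ← phi_add_left]; simp
  have point (p : ℤ × ℤ × ℤ) (hp : p ∈ Hstar n) :
      ∑ k ∈ hexFinset n, (if k = p then 1 else 0) * phi k t = phi p t := by
    simp only [ite_mul, one_mul, zero_mul]
    rw [Finset.sum_ite_eq', if_pos (mem_hexFinset.2 hp)]
  have rX : phi (1, -1, 0) t = 1 ↔ (3 * n : ℤ) ∣ m.1 - m.2.1 := by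
    rw [phi_pt_eq_one_iff hn]; ring_nf
  have rY : phi (0, 1, -1) t = 1 ↔ (3 * n : ℤ) ∣ m.2.1 - m.2.2 := by
    rw [phi_pt_eq_one_iff hn]; ring_nf
  have core := geom_hexagon rfl hXY.symm hZX hXYZ hw
  simp only [rX, rY] at core
  rw [← core]
  have R₁ := sum_rhombus (n := n) t (1, -1, 0) (0, 1, -1)
    (fun k => 0 ≤ k.1 ∧ k.1 < n ∧ k.2.2 < 0 ∧ -(n : ℤ) ≤ k.2.2)
    (fun k => k.1) (fun k => -k.2.2 - 1)
    (by intro a b ha hb; simp [Hstar]; omega)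
    (by rintro ⟨a, b, c⟩ hk hP; simp [Hstar] at hk hP ⊢; omega)
  have R₂ := sum_rhombus (n := n) t (0, 1, -1) (-1, 0, 1)
    (fun k => 0 ≤ k.2.1 ∧ k.2.1 < n ∧ k.1 < 0 ∧ -(n : ℤ) ≤ k.1)
    (fun k => k.2.1) (fun k => -k.1 - 1)
    (by intro a b ha hb; simp [Hstar]; omega)
    (by rintro ⟨a, b, c⟩ hk hP; simp [Hstar] at hk hP ⊢; omega)
  have R₃ := sum_rhombus (n := n) t (-1, 0, 1) (1, -1, 0)
    (fun k => 0 ≤ k.2.2 ∧ k.2.2 < n ∧ k.2.1 < 0 ∧ -(n : ℤ) ≤ k.2.1)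
    (fun k => k.2.2) (fun k => -k.2.1 - 1)
    (by intro a b ha hb; simp [Hstar]; omega)
    (by rintro ⟨a, b, c⟩ hk hP; simp [Hstar] at hk hP ⊢; omega)
  have R₄ := sum_rhombus (n := n) t (0, 1, -1) (1, -1, 0)
    (fun k => 0 < k.1 ∧ k.1 ≤ n ∧ k.2.2 ≤ 0 ∧ -(n : ℤ) < k.2.2)
    (fun k => -k.2.2) (fun k => k.1 - 1)
    (by intro a b ha hb; simp [Hstar]; omega)
    (by rintro ⟨a, b, c⟩ hk hP; simp [Hstar] at hk hP ⊢; omega)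
  have R₅ := sum_rhombus (n := n) t (-1, 0, 1) (0, 1, -1)
    (fun k => 0 < k.2.1 ∧ k.2.1 ≤ n ∧ k.1 ≤ 0 ∧ -(n : ℤ) < k.1)
    (fun k => -k.1) (fun k => k.2.1 - 1)
    (by intro a b ha hb; simp [Hstar]; omega)
    (by rintro ⟨a, b, c⟩ hk hP; simp [Hstar] at hk hP ⊢; omega)
  have R₆ := sum_rhombus (n := n) t (1, -1, 0) (-1, 0, 1)
    (fun k => 0 < k.2.2 ∧ k.2.2 ≤ n ∧ k.2.1 ≤ 0 ∧ -(n : ℤ) < k.2.1)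
    (fun k => -k.2.1) (fun k => k.2.2 - 1)
    (by intro a b ha hb; simp [Hstar]; omega)
    (by rintro ⟨a, b, c⟩ hk hP; simp [Hstar] at hk hP ⊢; omega)
  rw [Finset.sum_congr rfl fun k hk => by rw [cwt_eq_indicators hn (mem_hexFinset.1 hk)]]
  simp only [add_mul, sub_mul, mul_assoc (_ / _ : ℂ), Finset.sum_add_distrib,
    Finset.sum_sub_distrib, ← Finset.mul_sum]
  rw [R₁, R₂, R₃, R₄, R₅, R₆, point _ (by simp [Hstar]), point _ (by simp [Hstar]),
    point _ (by simp [Hstar]), point _ (by simp [Hstar]), point _ (by simp [Hstar]),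
    point _ (by simp [Hstar]), point _ (by simp [Hstar]),
    near₁, near₂, near₃, far₁, far₂, far₃, zero]
  ring

lemma PhiStar_pt {n : ℕ} (hn : 1 ≤ n) {m : ℤ × ℤ × ℤ} (hm : m.1 + m.2.1 + m.2.2 = 0) :
    PhiStar n (pt n m) =
      if (3 * n : ℤ) ∣ m.1 - m.2.1 ∧ (3 * n : ℤ) ∣ m.2.1 - m.2.2 then 1 else 0 := by
  have hn0 : (n : ℂ) ≠ 0 := by exact_mod_cast (by omega : n ≠ 0)
  rw [PhiStar_eq_sum, sum_hexFinset hn hm, mul_ite, mul_zero, one_div_mul_cancel (by simpa using hn0)]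

lemma three_mul_dvd_iff {n : ℕ} (hn : 1 ≤ n) {d : ℤ} (h₁ : -(4 * n : ℤ) ≤ d)
    (h₂ : d ≤ 4 * n) : (3 * n : ℤ) ∣ d ↔ d = 0 ∨ d = 3 * n ∨ d = -(3 * n) := by
  constructor
  · rintro ⟨q, rfl⟩
    have hq₁ : q < 2 := by nlinarith
    have hq₂ : -2 < q := by nlinarith
    interval_cases q <;> omega
  · rintro (rfl | rfl | rfl) <;> simp

/-- Number of elements of the reflection group fixing a node modulo the period lattice. -/
lemma orbit_count {n a b c : ℤ} (hn : 1 ≤ n)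
    (h : a + b + c = 0 ∧ 0 ≤ a ∧ 0 ≤ b ∧ -c ≤ n) :
    (if (a - b - (a - b) = 0 ∨ a - b - (a - b) = 3 * n ∨ a - b - (a - b) = -(3 * n)) ∧
        (b - c - (b - c) = 0 ∨ b - c - (b - c) = 3 * n ∨ b - c - (b - c) = -(3 * n))
        then (1 : ℤ) else 0) +
    (if (c - a - (a - b) = 0 ∨ c - a - (a - b) = 3 * n ∨ c - a - (a - b) = -(3 * n)) ∧
        (a - b - (b - c) = 0 ∨ a - b - (b - c) = 3 * n ∨ a - b - (b - c) = -(3 * n))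
        then 1 else 0) +
    (if (b - c - (a - b) = 0 ∨ b - c - (a - b) = 3 * n ∨ b - c - (a - b) = -(3 * n)) ∧
        (c - a - (b - c) = 0 ∨ c - a - (b - c) = 3 * n ∨ c - a - (b - c) = -(3 * n))
        then 1 else 0) +
    (if (-a - -c - (a - b) = 0 ∨ -a - -c - (a - b) = 3 * n ∨ -a - -c - (a - b) = -(3 * n)) ∧
        (-c - -b - (b - c) = 0 ∨ -c - -b - (b - c) = 3 * n ∨ -c - -b - (b - c) = -(3 * n))
        then 1 else 0) +
    (if (-b - -a - (a - b) = 0 ∨ -b - -a - (a - b) = 3 * n ∨ -b - -a - (a - b) = -(3 * n)) ∧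
        (-a - -c - (b - c) = 0 ∨ -a - -c - (b - c) = 3 * n ∨ -a - -c - (b - c) = -(3 * n))
        then 1 else 0) +
    (if (-c - -b - (a - b) = 0 ∨ -c - -b - (a - b) = 3 * n ∨ -c - -b - (a - b) = -(3 * n)) ∧
        (-b - -a - (b - c) = 0 ∨ -b - -a - (b - c) = 3 * n ∨ -b - -a - (b - c) = -(3 * n))
        then 1 else 0) =
    if 0 < a ∧ 0 < b ∧ -c < n then 1 else
      if (a = n ∧ b = 0 ∧ c = -n) ∨ (a = 0 ∧ b = n ∧ c = -n) ∨ (a = 0 ∧ b = 0 ∧ c = 0) then 6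
      else 2 := by
  grind (splits := 60)

lemma ellD_pt {n : ℕ} (hn : 1 ≤ n) {i j : ℤ × ℤ × ℤ} (hi : i ∈ Lamn n) (hj : j ∈ Lamn n) :
    ellD n j (pt n i) = if i = j then 1 else 0 := by
  obtain ⟨a, b, c⟩ := i
  obtain ⟨p, q, r⟩ := j
  simp only [Lamn, Set.mem_ofPred_eq] at hi hj
  have value (x y z : ℤ) (hxyz : x + y + z = 0) (s : ℝ × ℝ × ℝ) (hs : s = pt n (x, y, z))
      (hb : |x - y| ≤ 2 * n ∧ |y - z| ≤ 2 * n) :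
      PhiStar n (s - pt n (p, q, r)) =
        if (x - y - (p - q) = 0 ∨ x - y - (p - q) = 3 * n ∨ x - y - (p - q) = -(3 * n)) ∧
          (y - z - (q - r) = 0 ∨ y - z - (q - r) = 3 * n ∨ y - z - (q - r) = -(3 * n))
        then 1 else 0 := by
    have e : s - pt n (p, q, r) = pt n (x - p, y - q, z - r) := by
      rw [hs]; simp only [pt, Prod.mk_sub_mk]; push_cast; simp only [sub_div]
    simp only [abs_le] at hb
    rw [e, PhiStar_pt hn (by simp only; omega)]
    refine if_congr (and_congr ?_ ?_) rfl rfl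
    · rw [show x - p - (y - q) = x - y - (p - q) by ring]
      exact three_mul_dvd_iff hn (by omega) (by omega)
    · rw [show y - q - (z - r) = y - z - (q - r) by ring]
      exact three_mul_dvd_iff hn (by omega) (by omega)
  have hneg (x y z : ℤ) : (-((x : ℝ) / n), -((y : ℝ) / n), -((z : ℝ) / n)) =
      pt n (-x, -y, -z) := by
    simp [pt, neg_div]
  set u := pt n (a, b, c)
  simp only [ellD, Pplus]
  rw [value a b c (by omega) (u.1, u.2.1, u.2.2) rfl (by simp only [abs_le]; omega),
    value c a b (by omega) (u.2.2, u.1, u.2.1) rfl (by simp only [abs_le]; omega),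
    value b c a (by omega) (u.2.1, u.2.2, u.1) rfl (by simp only [abs_le]; omega),
    value (-a) (-c) (-b) (by omega) (-u.1, -u.2.2, -u.2.1) (hneg _ _ _)
      (by simp only [abs_le]; omega),
    value (-b) (-a) (-c) (by omega) (-u.2.1, -u.1, -u.2.2) (hneg _ _ _)
      (by simp only [abs_le]; omega),
    value (-c) (-b) (-a) (by omega) (-u.2.2, -u.2.1, -u.1) (hneg _ _ _)
      (by simp only [abs_le]; omega)]
  simp only [Prod.mk.injEq]
  by_cases h : a = p ∧ b = q ∧ c = r
  · obtain ⟨rfl, rfl, rfl⟩ := h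
    have hcount := congrArg (Int.cast : ℤ → ℂ) (orbit_count (n := n) (by omega) hi)
    push_cast at hcount
    rw [hcount]
    simp only [lamwt, Prod.mk.injEq, and_self, if_true]
    split_ifs <;> norm_num
  · rw [if_neg h, if_neg (by omega), if_neg (by omega), if_neg (by omega), if_neg (by omega),
      if_neg (by omega), if_neg (by omega)]
    ring

lemma finite_Lamn (n : ℕ) : (Lamn n).Finite := by
  refine ((Finset.finite_toSet (hexFinset n))).subset fun k hk => ?_
  simp only [Lamn, Set.mem_ofPred_eq] at hk
  simp only [coe_hexFinset, Hstar, Set.mem_ofPred_eq]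
  omega

lemma interpolation_pt {n : ℕ} (hn : 1 ≤ n) (f : ℤ × ℤ × ℤ → ℂ) {j : ℤ × ℤ × ℤ}
    (hj : j ∈ Lamn n) : ∑ᶠ l ∈ Lamn n, f l * ellD n l (pt n j) = f j := by
  rw [finsum_mem_congr rfl fun l hl => by rw [ellD_pt hn hj hl],
    finsum_mem_eq_finite_toFinset_sum _ (finite_Lamn n)]
  simp [hj]

lemma interpolation_mem_span (n : ℕ) (f : ℤ × ℤ × ℤ → ℂ) :
    (fun t => ∑ᶠ j ∈ Lamn n, f j * ellD n j t) ∈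
      Submodule.span ℂ {F | ∃ k ∈ Lamn n, F = TCos k} := by
  have e : (fun t => ∑ᶠ j ∈ Lamn n, f j * ellD n j t) =
      ∑ j ∈ (finite_Lamn n).toFinset, f j • ellD n j := by
    funext t
    rw [finsum_mem_eq_finite_toFinset_sum _ (finite_Lamn n), Finset.sum_apply]
    rfl
  rw [e]
  exact Submodule.sum_mem _ fun j _ => Submodule.smul_mem _ _ (ellD_mem_span n j)

/-- A function in the span of the cosines is determined by its values at the nodes. -/
lemma eq_of_eq_on_nodes {n : ℕ} (hn : 1 ≤ n) {g h : ℝ × ℝ × ℝ → ℂ}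
    (hg : g ∈ Submodule.span ℂ {F | ∃ k ∈ Lamn n, F = TCos k})
    (hh : h ∈ Submodule.span ℂ {F | ∃ k ∈ Lamn n, F = TCos k})
    (hgh : ∀ j ∈ Lamn n, g (pt n j) = h (pt n j)) : g = h := by
  have : Fintype (Lamn n) := (finite_Lamn n).fintype
  have hset : {F | ∃ k ∈ Lamn n, F = TCos k} = Set.range fun k : Lamn n => TCos k := by
    ext F
    simp [eq_comm]
  rw [hset] at hg hh
  set W := Submodule.span ℂ (Set.range fun k : Lamn n => TCos k)
  have : FiniteDimensional ℂ W := FiniteDimensional.span_of_finite ℂ (Set.finite_range _)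
  let ev : W →ₗ[ℂ] (Lamn n → ℂ) :=
    (LinearMap.pi fun j : Lamn n => LinearMap.proj (pt n j)).comp W.subtype
  have hsurj : Function.Surjective ev := by
    intro v
    let f : ℤ × ℤ × ℤ → ℂ := fun k => if hk : k ∈ Lamn n then v ⟨k, hk⟩ else 0
    refine ⟨⟨_, hset ▸ interpolation_mem_span n f⟩, ?_⟩
    funext j
    have := interpolation_pt hn f j.2
    simp only [f, Subtype.coe_eta, j.2, dite_true] at this
    exact this
  have hle : Module.finrank ℂ W ≤ Module.finrank ℂ (Lamn n → ℂ) := by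
    rw [Module.finrank_fintype_fun_eq_card]
    exact finrank_range_le_card _
  have heq := le_antisymm hle (LinearMap.finrank_le_finrank_of_surjective hsurj)
  have hinj := (LinearMap.injective_iff_surjective_of_finrank_eq_finrank heq).2 hsurj
  have : (⟨g, hg⟩ : W) = ⟨h, hh⟩ := hinj (funext fun j => hgh j j.2)
  exact congrArg Subtype.val this

theorem stmt_15 (n : ℕ) (hn : 1 ≤ n) (f : ℝ × ℝ × ℝ → ℂ) :
    (fun t => ∑ᶠ j ∈ Lamn n, f (pt n j) * ellD n j t) ∈
      Submodule.span ℂ {F | ∃ k ∈ Lamn n, F = TCos k} ∧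
    (∀ j ∈ Lamn n,
      (∑ᶠ l ∈ Lamn n, f (pt n l) * ellD n l (pt n j)) = f (pt n j)) ∧
    (∀ h ∈ Submodule.span ℂ {F | ∃ k ∈ Lamn n, F = TCos k},
      (∀ j ∈ Lamn n, h (pt n j) = f (pt n j)) →
      h = fun t => ∑ᶠ j ∈ Lamn n, f (pt n j) * ellD n j t) := by
  have hspan := interpolation_mem_span n fun j => f (pt n j)
  have hval : ∀ j ∈ Lamn n, ∑ᶠ l ∈ Lamn n, f (pt n l) * ellD n l (pt n j) = f (pt n j) :=
    fun j hj => interpolation_pt hn (fun j => f (pt n j)) hj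
  exact ⟨hspan, hval, fun h hh hf =>
    eq_of_eq_on_nodes hn hh hspan fun j hj => (hf j hj).trans (hval j hj).symm⟩
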